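/- arXiv:2210.09137 — 2 statements merged into one kernel-verified Lean document; each statement's English description precedes it below -/
import Mathlib

section
/- Let α > 0 and let g : [0,∞) → [0,∞) be an integrable α-concave function with g(0) > 0. Then the function G_g(p) := ( ((1/α + p) choose (1/α)) · (1/g(0)) · ∫₀^∞ p t^{p−1} g(t) dt )^{1/p} is decreasing in p on (0,∞), i.e. for all 0 < p < q one has G_g(q) ≤ G_g(p). -/
open MeasureTheory Real Set

/-- Generalized binomial coefficient `(x choose y) = Γ(1+x)/(Γ(1+y)Γ(1+x-y))`. -/
noncomputable def gbinom (x y : ℝ) : ℝ :=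
  Real.Gamma (1 + x) / (Real.Gamma (1 + y) * Real.Gamma (1 + x - y))

lemma aux_beta (p a : ℝ) (hp : 0 < p) (ha : 0 < a) :
    ∫ x in (0:ℝ)..1, x ^ (p - 1) * (1 - x) ^ a =
      Real.Gamma p * Real.Gamma (a + 1) / Real.Gamma (p + (a + 1)) := by
  have h := Complex.Gamma_mul_Gamma_eq_betaIntegral (s := (p : ℂ)) (t := ((a + 1 : ℝ) : ℂ))
    (by simpa using hp) (by simp; linarith)
  have hb : Complex.betaIntegral (p : ℂ) ((a + 1 : ℝ) : ℂ) =
      ((∫ x in (0:ℝ)..1, x ^ (p - 1) * (1 - x) ^ a : ℝ) : ℂ) := by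
    rw [Complex.betaIntegral, ← intervalIntegral.integral_ofReal]
    apply intervalIntegral.integral_congr
    intro x hx
    rw [uIcc_of_le zero_le_one] at hx
    have h1 : (0:ℝ) ≤ 1 - x := by linarith [hx.2]
    simp only
    rw [Complex.ofReal_mul, Complex.ofReal_cpow hx.1, Complex.ofReal_cpow h1]
    push_cast
    ring_nf
  rw [hb, ← Complex.ofReal_add, Complex.Gamma_ofReal, Complex.Gamma_ofReal,
    Complex.Gamma_ofReal] at h
  have h' : Real.Gamma p * Real.Gamma (a + 1) = Real.Gamma (p + (a + 1)) *
    ∫ x in (0:ℝ)..1, x ^ (p - 1) * (1 - x) ^ a := by exact_mod_cast h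
  have : 0 < Real.Gamma (p + (a + 1)) := Real.Gamma_pos_of_pos (by linarith)
  rw [h']
  field_simp

lemma aux_gbinom_pos (p a : ℝ) (hp : 0 < p) (ha : 0 < a) : 0 < gbinom (a + p) a := by
  unfold gbinom
  have h1 := Real.Gamma_pos_of_pos (show 0 < 1 + (a + p) by linarith)
  have h2 := Real.Gamma_pos_of_pos (show 0 < 1 + a by linarith)
  have h3 := Real.Gamma_pos_of_pos (show 0 < 1 + (a + p) - a by linarith)
  positivity

lemma aux_cone (p a m c : ℝ) (hp : 0 < p) (ha : 0 < a) (hc : 0 < c) :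
    ∫ t in Ioi (0:ℝ), p * t ^ (p - 1) * (m * (max 0 (1 - t / c)) ^ a) =
      m * c ^ p / gbinom (a + p) a := by
  have e1 : ∫ t in Ioi (0:ℝ), p * t ^ (p - 1) * (m * (max 0 (1 - t / c)) ^ a) =
      ∫ t in Ioi (0:ℝ), (p * m * c ^ (p - 1)) *
        (fun x : ℝ => x ^ (p - 1) * (max 0 (1 - x)) ^ a) (c⁻¹ * t) := by
    apply setIntegral_congr_fun measurableSet_Ioi
    intro t ht
    have ht : 0 < t := ht
    simp only
    rw [Real.mul_rpow (by positivity) ht.le, Real.inv_rpow hc.le]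
    have : 0 < c ^ (p - 1) := by positivity
    field_simp
  have e2 : ∫ x in Ioi (0:ℝ), x ^ (p - 1) * (max 0 (1 - x)) ^ a =
      Real.Gamma p * Real.Gamma (a + 1) / Real.Gamma (p + (a + 1)) := by
    rw [← aux_beta p a hp ha, intervalIntegral.integral_of_le zero_le_one,
      setIntegral_eq_of_subset_of_forall_sdiff_eq_zero measurableSet_Ioi
        (Ioc_subset_Ioi_self : Ioc (0:ℝ) 1 ⊆ Ioi 0) ?_]
    · apply setIntegral_congr_fun measurableSet_Ioc
      intro x hx
      simp only
      rw [max_eq_right (by linarith [hx.2])]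
    · intro x hx
      have : 1 < x := by
        by_contra h
        exact hx.2 ⟨hx.1, not_lt.1 h⟩
      rw [max_eq_left (by linarith), Real.zero_rpow ha.ne', mul_zero]
  rw [e1, integral_const_mul,
    integral_comp_mul_left_Ioi (fun x : ℝ => x ^ (p - 1) * (max 0 (1 - x)) ^ a) 0 (inv_pos.2 hc),
    mul_zero, e2]
  have hcp : c ^ p = c ^ (p - 1) * c := by
    rw [← Real.rpow_add_one hc.ne']; ring_nf
  have h1 := Real.Gamma_pos_of_pos (show 0 < p + (a + 1) by linarith)
  have h2 := Real.Gamma_pos_of_pos (show 0 < a + 1 by linarith)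
  have h3 := Real.Gamma_pos_of_pos hp
  have e3 : gbinom (a + p) a =
      Real.Gamma (p + (a + 1)) / (Real.Gamma (a + 1) * (p * Real.Gamma p)) := by
    unfold gbinom
    rw [← Real.Gamma_add_one hp.ne']
    ring_nf
  rw [e3, hcp, smul_eq_mul, inv_inv]
  field_simp

lemma aux_int (p K M : ℝ) (hp : 0 < p) (f : ℝ → ℝ)
    (hm : AEStronglyMeasurable f (volume.restrict (Ioi 0)))
    (h0 : ∀ t, 0 ≤ t → 0 ≤ f t) (hK : ∀ t, 0 ≤ t → f t ≤ K) (hM : ∀ t, 0 ≤ t → M < t → f t = 0) :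
    IntegrableOn (fun t => p * t ^ (p - 1) * f t) (Ioi 0) := by
  have hK0 : 0 ≤ K := (h0 0 le_rfl).trans (hK 0 le_rfl)
  have hi : IntegrableOn (fun t : ℝ => p * t ^ (p - 1) * K) (Ioc 0 (max M 0)) := by
    have := (intervalIntegral.intervalIntegrable_rpow' (a := 0) (b := max M 0)
      (show -1 < p - 1 by linarith))
    rw [intervalIntegrable_iff_integrableOn_Ioc_of_le (le_max_right _ _)] at this
    exact (this.const_mul p).mul_const K
  have hi2 := hi.integrable_indicator measurableSet_Ioc
  have hmeas : AEStronglyMeasurable (fun t => p * t ^ (p - 1) * f t)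
      (volume.restrict (Ioi 0)) := by
    refine AEStronglyMeasurable.mul ?_ hm
    exact (by fun_prop : Measurable fun t : ℝ => p * t ^ (p - 1)).aestronglyMeasurable
  refine Integrable.mono' (hi2.integrableOn (s := Ioi 0)) hmeas ?_
  filter_upwards [ae_restrict_mem measurableSet_Ioi] with t ht
  have ht : 0 < t := ht
  have hf0 := h0 t ht.le
  rw [Real.norm_of_nonneg (by positivity)]
  by_cases h : t ≤ max M 0
  · rw [indicator_of_mem (show t ∈ Ioc 0 (max M 0) from ⟨ht, h⟩)]
    exact mul_le_mul_of_nonneg_left (hK t ht.le) (by positivity)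
  · have : M < t := (le_max_left _ _).trans_lt (not_le.1 h)
    rw [hM t ht.le this, mul_zero]
    exact indicator_nonneg (fun x hx => by have := hx.1; positivity) _

lemma aux_three (α : ℝ) (g : ℝ → ℝ)
    (hgconc : ConcaveOn ℝ {t | 0 ≤ t ∧ 0 < g t} (fun t => g t ^ α))
    (s t u : ℝ) (hs : 0 ≤ s) (hst : s < t) (htu : t < u) (hgs : 0 < g s) (hgu : 0 < g u) :
    0 < g t ∧ (u - t) * g s ^ α + (t - s) * g u ^ α ≤ (u - s) * g t ^ α := by
  have hS : s ∈ {t | 0 ≤ t ∧ 0 < g t} := ⟨hs, hgs⟩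
  have hU : u ∈ {t | 0 ≤ t ∧ 0 < g t} := ⟨by linarith, hgu⟩
  have hus : 0 < u - s := by linarith
  have ha : 0 ≤ (u - t) / (u - s) := div_nonneg (by linarith) hus.le
  have hb : 0 ≤ (t - s) / (u - s) := div_nonneg (by linarith) hus.le
  have hab : (u - t) / (u - s) + (t - s) / (u - s) = 1 := by
    field_simp
    ring
  have e : ((u - t) / (u - s)) • s + ((t - s) / (u - s)) • u = t := by
    simp only [smul_eq_mul]
    field_simp
    ring
  have h1 := hgconc.1 hS hU ha hb hab
  have h2 := hgconc.2 hS hU ha hb hab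
  rw [e] at h1 h2
  refine ⟨h1.2, ?_⟩
  simp only [smul_eq_mul] at h2
  have h3 := mul_le_mul_of_nonneg_left h2 hus.le
  calc _ = (u - s) * ((u - t) / (u - s) * g s ^ α + (t - s) / (u - s) * g u ^ α) := by
        field_simp
    _ ≤ _ := h3

lemma aux_bdd (α : ℝ) (hα : 0 < α) (g : ℝ → ℝ)
    (hgnonneg : ∀ t, 0 ≤ t → 0 ≤ g t) (hgint : IntegrableOn g (Ici 0))
    (hg0 : 0 < g 0)
    (hgconc : ConcaveOn ℝ {t | 0 ≤ t ∧ 0 < g t} (fun t => g t ^ α)) :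
    ∃ M, 0 < M ∧ ∀ t, M < t → g t = 0 := by
  by_contra! hcon
  have hpos : ∀ t, 0 ≤ t → 0 < g t := by
    intro t ht
    obtain ⟨u, hu, hgu⟩ := hcon (t + 1) (by linarith)
    have hu0 : 0 < g u := lt_of_le_of_ne (hgnonneg u (by linarith)) (Ne.symm hgu)
    rcases ht.eq_or_lt with rfl | ht
    · exact hg0
    · exact (aux_three α g hgconc 0 t u le_rfl ht (by linarith) hg0 hu0).1
  have hlow : ∀ t, 0 ≤ t → (g 0 ^ α / 2) ^ (1 / α) ≤ g t := by
    intro t ht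
    have h0 : 0 < g 0 ^ α := by positivity
    have key : g 0 ^ α / 2 ≤ g t ^ α := by
      rcases ht.eq_or_lt with rfl | ht
      · linarith
      · have h := (aux_three α g hgconc 0 t (2 * t) le_rfl ht (by linarith) hg0
          (hpos _ (by linarith))).2
        have h' : 0 ≤ g (2 * t) ^ α := Real.rpow_nonneg (hpos _ (by linarith)).le _
        have : t * (g 0 ^ α) ≤ t * (2 * g t ^ α) := by nlinarith
        have := le_of_mul_le_mul_left this ht
        linarith
    calc _ ≤ (g t ^ α) ^ (1 / α) := Real.rpow_le_rpow (by positivity) key (by positivity)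
      _ = g t := by
        rw [← Real.rpow_mul (hgnonneg t ht), mul_one_div_cancel hα.ne', Real.rpow_one]
  set κ := (g 0 ^ α / 2) ^ (1 / α) with hκ
  have hκ0 : 0 < κ := by positivity
  have : IntegrableOn (fun _ : ℝ => κ) (Ici (0:ℝ)) := by
    refine Integrable.mono' hgint aestronglyMeasurable_const ?_
    filter_upwards [ae_restrict_mem measurableSet_Ici] with t ht
    rw [Real.norm_of_nonneg hκ0.le]
    exact hlow t ht
  rw [integrableOn_const_iff] at this
  rcases this with h | h
  · exact hκ0.ne' (by simpa using h)
  · simp at h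

lemma aux_le (α : ℝ) (hα : 0 < α) (x y : ℝ) (hx : 0 ≤ x) (h : x ^ α ≤ y) :
    x ≤ y ^ (1 / α) := by
  calc x = (x ^ α) ^ (1 / α) := by rw [← Real.rpow_mul hx, mul_one_div_cancel hα.ne', Real.rpow_one]
    _ ≤ _ := Real.rpow_le_rpow (by positivity) h (by positivity)

lemma aux_upper (α : ℝ) (hα : 0 < α) (g : ℝ → ℝ)
    (hgnonneg : ∀ t, 0 ≤ t → 0 ≤ g t)
    (hgconc : ConcaveOn ℝ {t | 0 ≤ t ∧ 0 < g t} (fun t => g t ^ α))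
    (hg0 : 0 < g 0)
    (M : ℝ) (hM : 0 < M) (hMz : ∀ t, M < t → g t = 0) :
    ∃ K, ∀ t, 0 ≤ t → g t ≤ K := by
  by_cases hex : ∃ m, 0 < m ∧ 0 < g m
  · obtain ⟨m, hm, hgm⟩ := hex
    obtain ⟨d, hd⟩ : ∃ d, d = m / 2 := ⟨_, rfl⟩
    have hd0 : 0 < d := by linarith
    have hmd : m = 2 * d := by linarith
    subst hmd
    have hgd := (aux_three α g hgconc 0 d (2 * d) le_rfl hd0 (by linarith) hg0 hgm).1
    have hH : 0 < g d ^ α := by positivity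
    have hbig : ∀ t, 0 ≤ t → 0 < g t → g t ^ α ≤ (2 + M / d) * g d ^ α := by
      intro t ht hgt
      have htM : t ≤ M := by
        by_contra h
        rw [hMz t (not_le.1 h)] at hgt
        exact lt_irrefl _ hgt
      have hHt : 0 ≤ g t ^ α := by positivity
      have hMd : 0 < M / d := by positivity
      rcases lt_trichotomy t d with h | h | h
      · have h3 := (aux_three α g hgconc t d (2 * d) ht h (by linarith) hgt hgm).2
        have h4 : 0 ≤ g (2 * d) ^ α := by positivity
        have h5 : d * g t ^ α ≤ d * (2 * g d ^ α) := by nlinarith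
        have h6 := le_of_mul_le_mul_left h5 hd0
        nlinarith
      · rw [h]
        nlinarith
      · have h3 := (aux_three α g hgconc 0 d t le_rfl hd0 h hg0 hgt).2
        have h4 : 0 ≤ g 0 ^ α := by positivity
        have h5 : d * g t ^ α ≤ M * g d ^ α := by nlinarith
        have h6 : g t ^ α ≤ M / d * g d ^ α := by
          rw [div_mul_eq_mul_div, le_div_iff₀ hd0]
          linarith
        nlinarith
    refine ⟨((2 + M / d) * g d ^ α) ^ (1 / α), fun t ht => ?_⟩
    have hnn : 0 ≤ (2 + M / d) * g d ^ α := by positivity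
    rcases (hgnonneg t ht).eq_or_lt with h | h
    · rw [← h]
      positivity
    · exact aux_le α hα _ _ h.le (hbig t ht h)
  · push Not at hex
    refine ⟨g 0, fun t ht => ?_⟩
    rcases ht.eq_or_lt with rfl | ht
    · exact le_rfl
    · exact (hex t ht).trans hg0.le

/-- Single crossing of `g` and the extremal profile. -/
lemma aux_cross (α : ℝ) (hα : 0 < α) (g : ℝ → ℝ)
    (hgnonneg : ∀ t, 0 ≤ t → 0 ≤ g t)
    (hgconc : ConcaveOn ℝ {t | 0 ≤ t ∧ 0 < g t} (fun t => g t ^ α))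
    (hg0 : 0 < g 0) (c : ℝ) (t s : ℝ) (ht : 0 < t) (hts : t < s)
    (h : g t < g 0 * (max 0 (1 - t / c)) ^ (1 / α)) :
    g s ≤ g 0 * (max 0 (1 - s / c)) ^ (1 / α) := by
  have hnn : 0 ≤ g 0 * (max 0 (1 - s / c)) ^ (1 / α) := by positivity
  rcases (hgnonneg s (by linarith)).eq_or_lt with h0 | hgs
  · rw [← h0]
    exact hnn
  have h3 := (aux_three α g hgconc 0 t s le_rfl ht hts hg0 hgs).2
  have hroot : (g 0 ^ α) ^ (1 / α) = g 0 := by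
    rw [← Real.rpow_mul hg0.le, mul_one_div_cancel hα.ne', Real.rpow_one]
  have hH : 0 < g 0 ^ α := by positivity
  -- raise the hypothesis to the power `α`
  have h1 : g t ^ α < g 0 ^ α * max 0 (1 - t / c) := by
    have := Real.rpow_lt_rpow (hgnonneg t ht.le) h hα
    rwa [Real.mul_rpow hg0.le (by positivity), ← Real.rpow_mul (le_max_left _ _),
      one_div_mul_cancel hα.ne', Real.rpow_one] at this
  have htc : max 0 (1 - t / c) = 1 - t / c := by
    apply max_eq_right
    by_contra hneg
    rw [max_eq_left (not_le.1 hneg).le, mul_zero] at h1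
    exact absurd h1 (not_lt.2 (Real.rpow_nonneg (hgnonneg t ht.le) _))
  rw [htc] at h1
  have h4 : t * g s ^ α ≤ t * (g 0 ^ α * (1 - s / c)) := by
    have h5 : s * g t ^ α ≤ s * (g 0 ^ α * (1 - t / c)) :=
      mul_le_mul_of_nonneg_left h1.le (by linarith)
    have e1 : s * (g 0 ^ α * (1 - t / c)) - (s - t) * g 0 ^ α = t * (g 0 ^ α * (1 - s / c)) := by
      ring
    linarith
  have h6 := le_of_mul_le_mul_left h4 ht
  have h7 : g s ^ α ≤ g 0 ^ α * max 0 (1 - s / c) :=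
    h6.trans (mul_le_mul_of_nonneg_left (le_max_right _ _) hH.le)
  have h8 := aux_le α hα _ _ hgs.le h7
  rwa [Real.mul_rpow hH.le (le_max_left _ _), hroot] at h8

theorem statement4 (α : ℝ) (hα : 0 < α) (g : ℝ → ℝ)
    (hgnonneg : ∀ t, 0 ≤ t → 0 ≤ g t) (hgint : IntegrableOn g (Ici 0))
    (hg0 : 0 < g 0)
    (hgconc : ConcaveOn ℝ {t | 0 ≤ t ∧ 0 < g t} (fun t => g t ^ α))
    (G : ℝ → ℝ)
    (hG : ∀ p : ℝ, G p =
      (gbinom (1 / α + p) (1 / α) * (1 / g 0) *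
        ∫ t in Ioi (0:ℝ), p * t ^ (p - 1) * g t) ^ (1 / p)) :
    ∀ p q : ℝ, 0 < p → p < q → G q ≤ G p := by
  intro p q hp hpq
  have hq : 0 < q := hp.trans hpq
  have hα' : 0 < 1 / α := by positivity
  obtain ⟨M, hM, hMz⟩ := aux_bdd α hα g hgnonneg hgint hg0 hgconc
  obtain ⟨K, hK⟩ := aux_upper α hα g hgnonneg hgconc hg0 M hM hMz
  have hmeas : AEStronglyMeasurable g (volume.restrict (Ioi 0)) :=
    (hgint.mono_set Ioi_subset_Ici_self).aestronglyMeasurable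
  have hI : ∀ r, 0 < r → IntegrableOn (fun t => r * t ^ (r - 1) * g t) (Ioi 0) := fun r hr =>
    aux_int r K M hr g hmeas hgnonneg hK (fun t _ h => hMz t h)
  have hnn : ∀ r, 0 < r → 0 ≤ᵐ[volume.restrict (Ioi (0:ℝ))] fun t => r * t ^ (r - 1) * g t := by
    intro r hr
    filter_upwards [ae_restrict_mem measurableSet_Ioi] with t ht
    have ht : 0 < t := ht
    have := hgnonneg t ht.le
    simp only [Pi.zero_apply]
    positivity
  have hInn : ∀ r, 0 < r → 0 ≤ ∫ t in Ioi (0:ℝ), r * t ^ (r - 1) * g t := fun r hr =>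
    integral_nonneg_of_ae (hnn r hr)
  have hAp := aux_gbinom_pos p (1 / α) hp hα'
  have hAq := aux_gbinom_pos q (1 / α) hq hα'
  have hGp : 0 ≤ G p := by
    rw [hG]
    have := hInn p hp
    positivity
  rcases (hInn p hp).eq_or_lt with h0 | hIp
  · -- degenerate case
    have hz := (integral_eq_zero_iff_of_nonneg_ae (hnn p hp) (hI p hp)).1 h0.symm
    have hz' : ∫ t in Ioi (0:ℝ), q * t ^ (q - 1) * g t = 0 := by
      apply integral_eq_zero_of_ae
      filter_upwards [hz, ae_restrict_mem measurableSet_Ioi] with t h1 ht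
      have ht : 0 < t := ht
      simp only [Pi.zero_apply] at h1 ⊢
      have h2 : p * t ^ (p - 1) ≠ 0 := by positivity
      rw [(mul_eq_zero.1 h1).resolve_left h2, mul_zero]
    have : G q = 0 := by
      rw [hG, hz', mul_zero, Real.zero_rpow (by positivity)]
    rw [this]
    exact hGp
  obtain ⟨c, hcdef⟩ : ∃ c, c = G p := ⟨_, rfl⟩
  have hc : 0 < c := by
    rw [hcdef, hG]
    positivity
  have hcp : c ^ p = gbinom (1 / α + p) (1 / α) * (1 / g 0) *
      ∫ t in Ioi (0:ℝ), p * t ^ (p - 1) * g t := by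
    rw [hcdef, hG, ← Real.rpow_mul (by positivity), one_div_mul_cancel hp.ne', Real.rpow_one]
  obtain ⟨f, hf⟩ : ∃ f : ℝ → ℝ, f = fun t => g 0 * (max 0 (1 - t / c)) ^ (1 / α) := ⟨_, rfl⟩
  have hfnn : ∀ t, 0 ≤ f t := by
    intro t
    rw [hf]
    positivity
  have hfz : ∀ t, c < t → f t = 0 := by
    intro t ht
    have : 1 < t / c := by rwa [one_lt_div hc]
    simp only [hf]
    rw [max_eq_left (by linarith), Real.zero_rpow hα'.ne', mul_zero]
  have hfK : ∀ t, 0 ≤ t → f t ≤ g 0 := by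
    intro t ht
    have h1 : 0 ≤ t / c := by positivity
    have h2 : (max 0 (1 - t / c)) ^ (1 / α) ≤ 1 :=
      Real.rpow_le_one (le_max_left _ _) (max_le zero_le_one (by linarith)) hα'.le
    simp only [hf]
    nlinarith
  have hfm : Measurable f := by
    rw [hf]
    fun_prop
  have hJ : ∀ r, 0 < r → IntegrableOn (fun t => r * t ^ (r - 1) * f t) (Ioi 0) := fun r hr =>
    aux_int r (g 0) c hr f hfm.aestronglyMeasurable (fun t _ => hfnn t) hfK (fun t _ h => hfz t h)
  have hJv : ∀ r, 0 < r → ∫ t in Ioi (0:ℝ), r * t ^ (r - 1) * f t =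
      g 0 * c ^ r / gbinom (1 / α + r) (1 / α) := by
    intro r hr
    rw [hf]
    exact aux_cone r (1 / α) (g 0) c hr hα' hc
  have hJp : ∫ t in Ioi (0:ℝ), p * t ^ (p - 1) * f t = ∫ t in Ioi (0:ℝ), p * t ^ (p - 1) * g t := by
    rw [hJv p hp, hcp]
    generalize gbinom (1 / α + p) (1 / α) = A at hAp
    field_simp
  -- the crossing point
  obtain ⟨τ, hτ0, hτ1, hτ2⟩ : ∃ τ, 0 ≤ τ ∧ (∀ t, 0 < t → t < τ → f t ≤ g t) ∧
      (∀ t, 0 < t → τ < t → g t ≤ f t) := by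
    obtain ⟨T, hT⟩ : ∃ T : Set ℝ, T = {t | 0 < t ∧ (g t < f t ∨ max M c < t)} := ⟨_, rfl⟩
    have hTne : T.Nonempty := by
      refine ⟨max M c + 1, ?_⟩
      rw [hT]
      have := le_max_left M c
      exact ⟨by linarith, Or.inr (by linarith)⟩
    have hTb : ∀ t ∈ T, (0:ℝ) ≤ t := by
      intro t ht
      rw [hT] at ht
      exact ht.1.le
    refine ⟨sInf T, le_csInf hTne hTb, ?_, ?_⟩
    · intro t ht htT
      by_contra hlt
      have : t ∈ T := by
        rw [hT]
        exact ⟨ht, Or.inl (not_le.1 hlt)⟩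
      exact absurd (csInf_le ⟨0, hTb⟩ this) (not_le.2 htT)
    · intro s hs hsT
      obtain ⟨t, htT, hts⟩ := exists_lt_of_csInf_lt hTne hsT
      rw [hT] at htT
      rcases htT.2 with h | h
      · rw [hf] at h ⊢
        exact aux_cross α hα g hgnonneg hgconc hg0 c t s htT.1 hts h
      · rw [hMz s ((le_max_left M c).trans_lt (h.trans hts))]
        exact hfnn s
  have hmain : ∫ t in Ioi (0:ℝ), (q * t ^ (q - 1) * g t - q * t ^ (q - 1) * f t) ≤
      ∫ t in Ioi (0:ℝ), (q / p * τ ^ (q - p)) *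
        (p * t ^ (p - 1) * g t - p * t ^ (p - 1) * f t) := by
    apply setIntegral_mono_on ((hI q hq).sub (hJ q hq))
      (((hI p hp).sub (hJ p hp)).const_mul _) measurableSet_Ioi
    intro t ht
    have ht : 0 < t := ht
    have e : t ^ (q - 1) = t ^ (q - p) * t ^ (p - 1) := by
      rw [← Real.rpow_add ht]
      ring_nf
    have e2 : (q / p * τ ^ (q - p)) * (p * t ^ (p - 1) * g t - p * t ^ (p - 1) * f t) =
        (q * t ^ (p - 1)) * (τ ^ (q - p) * (g t - f t)) := by
      field_simp
    have e3 : q * t ^ (q - 1) * g t - q * t ^ (q - 1) * f t =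
        (q * t ^ (p - 1)) * (t ^ (q - p) * (g t - f t)) := by
      rw [e]
      ring
    simp only [Pi.sub_apply]
    rw [e2, e3]
    apply mul_le_mul_of_nonneg_left _ (by positivity)
    rcases lt_trichotomy t τ with h | h | h
    · have h1 := hτ1 t ht h
      have h2 := Real.rpow_le_rpow ht.le h.le (show 0 ≤ q - p by linarith)
      exact mul_le_mul_of_nonneg_right h2 (by linarith)
    · rw [h]
    · have h1 := hτ2 t ht h
      have h2 := Real.rpow_le_rpow hτ0 h.le (show 0 ≤ q - p by linarith)
      exact mul_le_mul_of_nonpos_right h2 (by linarith)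
  rw [integral_const_mul, integral_sub (hI q hq) (hJ q hq), integral_sub (hI p hp) (hJ p hp),
    hJp, sub_self, mul_zero, hJv q hq, sub_nonpos, le_div_iff₀ hAq] at hmain
  have hIq := hInn q hq
  have hfin : gbinom (1 / α + q) (1 / α) * (1 / g 0) *
      (∫ t in Ioi (0:ℝ), q * t ^ (q - 1) * g t) ≤ c ^ q := by
    have e : gbinom (1 / α + q) (1 / α) * (1 / g 0) *
      (∫ t in Ioi (0:ℝ), q * t ^ (q - 1) * g t) =
      ((∫ t in Ioi (0:ℝ), q * t ^ (q - 1) * g t) * gbinom (1 / α + q) (1 / α)) / g 0 := by ring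
    rw [e, div_le_iff₀ hg0]
    linarith
  rw [← hcdef, hG q]
  calc _ ≤ (c ^ q) ^ (1 / q) := Real.rpow_le_rpow (by positivity) hfin (by positivity)
    _ = c := by rw [← Real.rpow_mul hc.le, mul_one_div_cancel hq.ne', Real.rpow_one]
end

section
/- Let K ⊆ ℝⁿ be a convex body and let g_K be its covariogram. Then g_K is (1/n)-concave: for all x, y ∈ ℝⁿ with g_K(x) > 0 and g_K(y) > 0 and all λ ∈ [0,1], g_K((1−λ)x + λy)^{1/n} ≥ (1−λ)·g_K(x)^{1/n} + λ·g_K(y)^{1/n}. -/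
open MeasureTheory Real Set
open scoped RealInnerProductSpace Pointwise

/-- The covariogram function of a set `K ⊆ ℝⁿ`: `g_K(x) = |K ∩ (x + K)|`. -/
noncomputable def covariogram {n : ℕ} (K : Set (EuclideanSpace ℝ (Fin n)))
    (x : EuclideanSpace ℝ (Fin n)) : ℝ :=
  (volume (K ∩ {y | y - x ∈ K})).toReal

/-- Ball's body `K_p(g) = {x : ∫₀^∞ p t^(p-1) g(tx) dt ≥ g(0)}`. -/
noncomputable def ballBody {n : ℕ} (p : ℝ) (g : EuclideanSpace ℝ (Fin n) → ℝ) :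
    Set (EuclideanSpace ℝ (Fin n)) :=
  {x | g 0 ≤ ∫ t in Ioi (0:ℝ), p * t ^ (p - 1) * g (t • x)}

lemma bm_one_compact {A B C : Set ℝ} (hA : IsCompact A) (hB : IsCompact B)
    (hA0 : A.Nonempty) (hB0 : B.Nonempty) (h : ∀ a ∈ A, ∀ b ∈ B, a + b ∈ C) :
    volume A + volume B ≤ volume C := by
  obtain ⟨a, ha, hamax⟩ := hA.exists_isGreatest hA0
  obtain ⟨b, hb, hbmin⟩ := hB.exists_isLeast hB0
  have h1 : volume ((fun x => -b + x) ⁻¹' A) = volume A := measure_preimage_add _ _ _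
  have h2 : volume ((fun x => -a + x) ⁻¹' B) = volume B := measure_preimage_add _ _ _
  have hBm : MeasurableSet ((fun x => -a + x) ⁻¹' B) :=
    (measurable_const_add (-a)) hB.measurableSet
  rw [← h1, ← h2, ← measure_union_add_inter _ hBm]
  have h3 : ((fun x => -b + x) ⁻¹' A) ∩ ((fun x => -a + x) ⁻¹' B) ⊆ {a + b} := by
    rintro x ⟨hx1, hx2⟩
    have e1 := hamax hx1
    have e2 := hbmin hx2
    simp only [mem_singleton_iff]
    linarith
  have h4 : volume (((fun x => -b + x) ⁻¹' A) ∩ ((fun x => -a + x) ⁻¹' B)) = 0 :=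
    measure_mono_null h3 (by simp)
  rw [h4, add_zero]
  apply measure_mono
  rintro x (hx | hx)
  · have := h _ hx b hb
    simpa using this
  · have := h a ha _ hx
    simpa using this

lemma ennreal_add_le_of_forall_lt {a b c : ENNReal} (ha : a ≠ 0) (hb : b ≠ 0)
    (h : ∀ a' < a, ∀ b' < b, a' + b' ≤ c) : a + b ≤ c := by
  have hb' : ∀ a' < a, a' + b ≤ c := by
    intro a' ha'
    have : b ≤ c - a' := le_of_forall_lt_imp_le_of_dense fun b' hb' => by
      have hne : a' ≠ ⊤ := ne_top_of_lt ha'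
      have := h a' ha' b' hb'
      exact ENNReal.le_sub_of_add_le_left hne this
    have h0 : a' ≤ c := by simpa using h a' ha' 0 (pos_iff_ne_zero.2 hb)
    calc a' + b ≤ a' + (c - a') := by gcongr
      _ = c := add_tsub_cancel_of_le h0
  by_cases hbt : b = ⊤
  · have := hb' 0 (pos_iff_ne_zero.2 ha)
    simp [hbt] at this ⊢
    exact this
  have h0 : b ≤ c := by simpa using hb' 0 (pos_iff_ne_zero.2 ha)
  have : a ≤ c - b := le_of_forall_lt_imp_le_of_dense fun a' ha' => 
      ENNReal.le_sub_of_add_le_right hbt (hb' a' ha')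
  calc a + b ≤ (c - b) + b := by gcongr
    _ = c := tsub_add_cancel_of_le h0

lemma bm_one_add {A B C : Set ℝ} (hA : MeasurableSet A) (hB : MeasurableSet B)
    (hA0 : A.Nonempty) (hB0 : B.Nonempty) (h : ∀ a ∈ A, ∀ b ∈ B, a + b ∈ C) :
    volume A + volume B ≤ volume C := by
  obtain ⟨a, ha⟩ := hA0
  obtain ⟨b, hb⟩ := hB0
  by_cases hA1 : volume A = 0
  · rw [hA1, zero_add, ← measure_preimage_add volume (-a) B]
    apply measure_mono
    intro x hx
    simpa using h a ha _ hx
  by_cases hB1 : volume B = 0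
  · rw [hB1, add_zero, ← measure_preimage_add volume (-b) A]
    apply measure_mono
    intro x hx
    simpa using h _ hx b hb
  apply ennreal_add_le_of_forall_lt hA1 hB1
  intro u hu v hv
  obtain ⟨S, hS, hSc, hSu⟩ := hA.exists_lt_isCompact hu
  obtain ⟨T, hT, hTc, hTv⟩ := hB.exists_lt_isCompact hv
  refine (add_le_add hSu.le hTv.le).trans (bm_one_compact hSc hTc ?_ ?_ ?_)
  · exact nonempty_of_measure_ne_zero (ne_bot_of_gt hSu)
  · exact nonempty_of_measure_ne_zero (ne_bot_of_gt hTv)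
  · exact fun a ha b hb => h a (hS ha) b (hT hb)

lemma bm_one {A B C : Set ℝ} {p q : ℝ} (hp : 0 < p) (hq : 0 < q)
    (hA : MeasurableSet A) (hB : MeasurableSet B)
    (hA0 : A.Nonempty) (hB0 : B.Nonempty) (h : ∀ a ∈ A, ∀ b ∈ B, p * a + q * b ∈ C) :
    ENNReal.ofReal p * volume A + ENNReal.ofReal q * volume B ≤ volume C := by
  have h1 := Measure.addHaar_smul volume p A
  have h2 := Measure.addHaar_smul volume q B
  simp only [Module.finrank_self, pow_one, abs_of_pos hp, abs_of_pos hq] at h1 h2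
  rw [← h1, ← h2]
  apply bm_one_add (hA.const_smul₀ p) (hB.const_smul₀ q) hA0.smul_set hB0.smul_set
  rintro _ ⟨a, ha, rfl⟩ _ ⟨b, hb, rfl⟩
  exact h a ha b hb

lemma layer_one {f : ℝ → ENNReal} (hf : Measurable f) (hf1 : ∀ x, f x ≤ 1) :
    ∫⁻ x, f x = ∫⁻ t in Ioo (0:ℝ) 1, volume {x | ENNReal.ofReal t < f x} := by
  have hne : ∀ x, f x ≠ ⊤ := fun x => ne_top_of_le_ne_top ENNReal.one_ne_top (hf1 x)
  have h1 : ∫⁻ x, f x = ∫⁻ x, ENNReal.ofReal (f x).toReal := by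
    simp only [ENNReal.ofReal_toReal (hne _)]
  rw [h1, lintegral_eq_lintegral_meas_lt volume (ae_of_all _ fun x => ENNReal.toReal_nonneg)
    hf.ennreal_toReal.aemeasurable]
  have h2 : ∀ t ∈ Ioi (0:ℝ), volume {x | t < (f x).toReal} =
      (Ioo (0:ℝ) 1).indicator (fun t => volume {x | ENNReal.ofReal t < f x}) t := by
    intro t ht
    have ht' : (0:ℝ) < t := ht
    by_cases ht1 : t < 1
    · rw [indicator_of_mem (show t ∈ Ioo (0:ℝ) 1 from ⟨ht, ht1⟩)]
      congr 1
      ext x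
      simp only [mem_setOf_eq]
      exact (ENNReal.ofReal_lt_iff_lt_toReal ht'.le (hne x)).symm
    · rw [indicator_of_notMem (fun h => ht1 h.2)]
      have : {x | t < (f x).toReal} = ∅ := by
        ext x
        simp only [mem_setOf_eq, mem_empty_iff_false, iff_false, not_lt]
        have := ENNReal.toReal_mono ENNReal.one_ne_top (hf1 x)
        simp at this
        linarith
      simp [this]
  rw [setLIntegral_congr_fun measurableSet_Ioi h2, lintegral_indicator measurableSet_Ioo,
    Measure.restrict_restrict measurableSet_Ioo]
  congr 2
  ext x
  simp only [mem_inter_iff, mem_Ioo, mem_Ioi]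
  tauto

lemma amgm {a b : ENNReal} {p q : ℝ} (hp : 0 < p) (hq : 0 < q) (hpq : p + q = 1) :
    a ^ p * b ^ q ≤ ENNReal.ofReal p * a + ENNReal.ofReal q * b := by
  by_cases ha : a = ⊤
  · simp [ha, ENNReal.mul_top, hp]
  by_cases hb : b = ⊤
  · simp [hb, ENNReal.mul_top, hq]
  lift a to NNReal using ha
  lift b to NNReal using hb
  lift p to NNReal using hp.le
  lift q to NNReal using hq.le
  have := NNReal.geom_mean_le_arith_mean2_weighted p q a b (by exact_mod_cast hpq)
  rw [← ENNReal.coe_rpow_of_nonneg _ hp.le, ← ENNReal.coe_rpow_of_nonneg _ hq.le,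
    ENNReal.ofReal_coe_nnreal, ENNReal.ofReal_coe_nnreal]
  exact_mod_cast this

lemma pl_one_norm {f g h : ℝ → ENNReal} {p q : ℝ} (hp : 0 < p) (hq : 0 < q) (hpq : p + q = 1)
    (hf : Measurable f) (hg : Measurable g) (hh : Measurable h)
    (hf1 : ∀ x, f x ≤ 1) (hg1 : ∀ x, g x ≤ 1)
    (hf2 : ∀ t < 1, ∃ x, t < f x) (hg2 : ∀ t < 1, ∃ x, t < g x)
    (H : ∀ x y, f x ^ p * g y ^ q ≤ h (p * x + q * y)) :
    (∫⁻ x, f x) ^ p * (∫⁻ x, g x) ^ q ≤ ∫⁻ x, h x := by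
  refine (amgm hp hq hpq).trans ?_
  refine le_trans ?_ (lintegral_mono (fun x => min_le_left (h x) 1))
  rw [layer_one hf hf1, layer_one hg hg1,
    layer_one (hh.min measurable_const) (fun x => min_le_right _ _)]
  rw [← lintegral_const_mul' _ _ ENNReal.ofReal_ne_top,
    ← lintegral_const_mul' _ _ ENNReal.ofReal_ne_top]
  refine (le_lintegral_add _ _).trans ?_
  apply setLIntegral_mono' measurableSet_Ioo
  rintro t ⟨ht0, ht1⟩
  have ht1' : ENNReal.ofReal t < 1 := by simpa using ht1
  apply bm_one hp hq (measurableSet_lt measurable_const hf) (measurableSet_lt measurable_const hg)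
    (hf2 _ ht1') (hg2 _ ht1')
  intro a ha b hb
  simp only [mem_setOf_eq] at ha hb ⊢
  refine lt_min ?_ ht1'
  refine lt_of_lt_of_le ?_ (H a b)
  have e : ENNReal.ofReal t = ENNReal.ofReal t ^ p * ENNReal.ofReal t ^ q := by
    rw [← ENNReal.rpow_add _ _ (by simpa using ht0) ENNReal.ofReal_ne_top, hpq, ENNReal.rpow_one]
  rw [e]
  exact ENNReal.mul_lt_mul (ENNReal.rpow_lt_rpow ha hp) (ENNReal.rpow_lt_rpow hb hq)

lemma pl_one_bdd {f g h : ℝ → ENNReal} {p q : ℝ} (hp : 0 < p) (hq : 0 < q) (hpq : p + q = 1)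
    (hf : Measurable f) (hg : Measurable g) (hh : Measurable h)
    {M : ENNReal} (hM : M ≠ ⊤) (hf1 : ∀ x, f x ≤ M) (hg1 : ∀ x, g x ≤ M)
    (H : ∀ x y, f x ^ p * g y ^ q ≤ h (p * x + q * y)) :
    (∫⁻ x, f x) ^ p * (∫⁻ x, g x) ^ q ≤ ∫⁻ x, h x := by
  have hat : (⨆ x, f x) ≠ ⊤ := ne_top_of_le_ne_top hM (iSup_le hf1)
  have hbt : (⨆ x, g x) ≠ ⊤ := ne_top_of_le_ne_top hM (iSup_le hg1)
  by_cases ha0 : (⨆ x, f x) = 0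
  · have : ∀ x, f x = 0 := by simpa using ha0
    simp [this, hp]
  by_cases hb0 : (⨆ x, g x) = 0
  · have : ∀ x, g x = 0 := by simpa using hb0
    simp [this, hq]
  set a := ⨆ x, f x with ha
  set b := ⨆ x, g x with hb
  have hc0 : a ^ p * b ^ q ≠ 0 := by
    simp [ha0, hb0, hat, hbt, hp.le, hq.le, ENNReal.rpow_eq_zero_iff]
  have hct : a ^ p * b ^ q ≠ ⊤ :=
    ENNReal.mul_ne_top (ENNReal.rpow_ne_top_of_nonneg hp.le hat)
      (ENNReal.rpow_ne_top_of_nonneg hq.le hbt)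
  have hinv : (a ^ p * b ^ q)⁻¹ = a⁻¹ ^ p * b⁻¹ ^ q := by
    rw [ENNReal.mul_inv (Or.inr (ENNReal.rpow_ne_top_of_nonneg hq.le hbt))
      (Or.inl (ENNReal.rpow_ne_top_of_nonneg hp.le hat)), ENNReal.inv_rpow, ENNReal.inv_rpow]
  have aux : ∀ (k : ℝ → ENNReal), (⨆ x, k x) ≠ 0 → (⨆ x, k x) ≠ ⊤ →
      (∀ x, (⨆ x, k x)⁻¹ * k x ≤ 1) ∧ ∀ t < 1, ∃ x, t < (⨆ x, k x)⁻¹ * k x := by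
    intro k h0 ht
    constructor
    · intro x
      calc _ ≤ (⨆ x, k x)⁻¹ * (⨆ x, k x) := by gcongr; exact le_iSup k x
        _ = 1 := ENNReal.inv_mul_cancel h0 ht
    · intro t ht1
      have : ⨆ x, (⨆ x, k x)⁻¹ * k x = 1 := by
        rw [← ENNReal.mul_iSup, ENNReal.inv_mul_cancel h0 ht]
      rw [← this] at ht1
      exact lt_iSup_iff.1 ht1
  have key := pl_one_norm (f := fun x => a⁻¹ * f x) (g := fun x => b⁻¹ * g x)
    (h := fun x => (a ^ p * b ^ q)⁻¹ * h x) hp hq hpq (hf.const_mul _) (hg.const_mul _)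
    (hh.const_mul _) (aux f ha0 hat).1 (aux g hb0 hbt).1 (aux f ha0 hat).2 (aux g hb0 hbt).2 (by
      intro x y
      rw [ENNReal.mul_rpow_of_nonneg _ _ hp.le, ENNReal.mul_rpow_of_nonneg _ _ hq.le, hinv,
        mul_mul_mul_comm]
      gcongr
      exact H x y)
  rw [lintegral_const_mul _ hf, lintegral_const_mul _ hg, lintegral_const_mul _ hh,
    ENNReal.mul_rpow_of_nonneg _ _ hp.le, ENNReal.mul_rpow_of_nonneg _ _ hq.le,
    mul_mul_mul_comm, ← hinv] at key
  exact (ENNReal.mul_le_mul_iff_right (ENNReal.inv_ne_zero.2 hct) (ENNReal.inv_ne_top.2 hc0)).1 key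

lemma trunc_tendsto {f : ℝ → ENNReal} (hf : Measurable f) :
    Filter.Tendsto (fun k : ℕ => ∫⁻ x, min (f x) k) Filter.atTop (nhds (∫⁻ x, f x)) := by
  apply lintegral_tendsto_of_tendsto_of_monotone
  · exact fun k => (hf.min measurable_const).aemeasurable
  · refine ae_of_all _ fun x i j hij => ?_
    exact min_le_min le_rfl (by exact_mod_cast hij)
  · refine ae_of_all _ fun x => ?_
    have := (tendsto_const_nhds (x := f x)).min ENNReal.tendsto_nat_nhds_top
    simpa using this

lemma pl_one {f g h : ℝ → ENNReal} {p q : ℝ} (hp : 0 < p) (hq : 0 < q) (hpq : p + q = 1)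
    (hf : Measurable f) (hg : Measurable g) (hh : Measurable h)
    (H : ∀ x y, f x ^ p * g y ^ q ≤ h (p * x + q * y)) :
    (∫⁻ x, f x) ^ p * (∫⁻ x, g x) ^ q ≤ ∫⁻ x, h x := by
  by_cases hf0 : ∫⁻ x, f x = 0
  · simp [hf0, hp]
  by_cases hg0 : ∫⁻ x, g x = 0
  · simp [hg0, hq]
  have hf0' : (∫⁻ x, f x) ^ p ≠ 0 := by simp [ENNReal.rpow_eq_zero_iff, hf0, hp.le]
  have hg0' : (∫⁻ x, g x) ^ q ≠ 0 := by simp [ENNReal.rpow_eq_zero_iff, hg0, hq.le]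
  have ht := ENNReal.Tendsto.mul
    (((ENNReal.continuous_rpow_const (y := p)).tendsto _).comp (trunc_tendsto hf)) (Or.inl hf0')
    (((ENNReal.continuous_rpow_const (y := q)).tendsto _).comp (trunc_tendsto hg)) (Or.inl hg0')
  refine le_of_tendsto' ht fun k => ?_
  refine pl_one_bdd hp hq hpq (hf.min measurable_const) (hg.min measurable_const) hh
    (ENNReal.natCast_ne_top k) (fun x => min_le_right _ _) (fun x => min_le_right _ _) ?_
  intro x y
  refine le_trans ?_ (H x y)
  gcongr <;> exact min_le_left _ _

lemma pl_pi {p q : ℝ} (hp : 0 < p) (hq : 0 < q) (hpq : p + q = 1) (n : ℕ) :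
    ∀ {f g h : (Fin n → ℝ) → ENNReal},
    Measurable f → Measurable g → Measurable h →
    (∀ x y, f x ^ p * g y ^ q ≤ h (p • x + q • y)) →
    (∫⁻ x, f x) ^ p * (∫⁻ x, g x) ^ q ≤ ∫⁻ x, h x := by
  induction n with
  | zero =>
    intro f g h hf hg hh H
    rw [Measure.volume_pi_eq_dirac, lintegral_dirac, lintegral_dirac, lintegral_dirac]
    convert H _ _
  | succ n ih =>
    intro f g h hf hg hh H
    set e := MeasurableEquiv.piFinSuccAbove (fun _ : Fin (n+1) => ℝ) 0 with he
    have hmp : MeasurePreserving e.symm volume volume :=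
      (volume_preserving_piFinSuccAbove (fun _ : Fin (n+1) => ℝ) 0).symm e
    have key : ∀ k : (Fin (n+1) → ℝ) → ENNReal, Measurable k →
        ∫⁻ x, k x = ∫⁻ s : ℝ, ∫⁻ y : Fin n → ℝ, k (e.symm (s, y)) := by
      intro k hk
      rw [← hmp.lintegral_comp hk]
      exact lintegral_prod _ (hk.comp e.symm.measurable).aemeasurable
    have hm : ∀ k : (Fin (n+1) → ℝ) → ENNReal, Measurable k →
        Measurable fun s : ℝ => ∫⁻ y : Fin n → ℝ, k (e.symm (s, y)) := fun k hk =>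
      (hk.comp e.symm.measurable).lintegral_prod_right'
    have hm2 : ∀ k : (Fin (n+1) → ℝ) → ENNReal, Measurable k → ∀ s : ℝ,
        Measurable fun y : Fin n → ℝ => k (e.symm (s, y)) := fun k hk s =>
      (hk.comp e.symm.measurable).comp measurable_prodMk_left
    rw [key f hf, key g hg, key h hh]
    apply pl_one hp hq hpq (hm f hf) (hm g hg) (hm h hh)
    intro s t
    apply ih (hm2 f hf s) (hm2 g hg t) (hm2 h hh _)
    intro x y
    refine (H _ _).trans (le_of_eq ?_)
    congr 1
    ext i
    refine Fin.cases ?_ (fun j => ?_) i <;>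
      simp [he, MeasurableEquiv.piFinSuccAbove, Fin.insertNthEquiv]

lemma bm_mul {n : ℕ} {p q : ℝ} (hp : 0 < p) (hq : 0 < q) (hpq : p + q = 1)
    {A B C : Set (EuclideanSpace ℝ (Fin n))} (hA : MeasurableSet A) (hB : MeasurableSet B)
    (hC : MeasurableSet C) (H : ∀ a ∈ A, ∀ b ∈ B, p • a + q • b ∈ C) :
    volume A ^ p * volume B ^ q ≤ volume C := by
  have hmp := PiLp.volume_preserving_toLp (Fin n)
  rw [← hmp.measure_preimage hA.nullMeasurableSet, ← hmp.measure_preimage hB.nullMeasurableSet,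
    ← hmp.measure_preimage hC.nullMeasurableSet]
  have hA' := hmp.measurable hA
  have hB' := hmp.measurable hB
  have hC' := hmp.measurable hC
  rw [← lintegral_indicator_one hA', ← lintegral_indicator_one hB', ← lintegral_indicator_one hC']
  apply pl_pi hp hq hpq n (measurable_one.indicator hA') (measurable_one.indicator hB')
    (measurable_one.indicator hC')
  intro x y
  by_cases hx : WithLp.toLp 2 x ∈ A
  · by_cases hy : WithLp.toLp 2 y ∈ B
    · have : WithLp.toLp 2 (p • x + q • y) ∈ C := H _ hx _ hy
      have hm : p • x + q • y ∈ WithLp.toLp 2 ⁻¹' C := this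
      rw [indicator_of_mem hm]
      simp [indicator, hx, hy]
    · simp [indicator, hy, hq]
  · simp [indicator, hx, hp]

/-- Brunn-Minkowski, for sets of positive finite measure. -/
lemma bm_root {n : ℕ} (hn : n ≠ 0) {p q : ℝ} (hp : 0 < p) (hq : 0 < q)
    {A B C : Set (EuclideanSpace ℝ (Fin n))} (hA : MeasurableSet A) (hB : MeasurableSet B)
    (hC : MeasurableSet C) (hCt : volume C ≠ ⊤)
    (hA0 : 0 < (volume A).toReal) (hB0 : 0 < (volume B).toReal)
    (H : ∀ a ∈ A, ∀ b ∈ B, p • a + q • b ∈ C) :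
    p * (volume A).toReal ^ ((1:ℝ) / n) + q * (volume B).toReal ^ ((1:ℝ) / n) ≤
      (volume C).toReal ^ ((1:ℝ) / n) := by
  set α := (volume A).toReal ^ ((1:ℝ) / n) with hα
  set β := (volume B).toReal ^ ((1:ℝ) / n) with hβ
  have hα0 : 0 < α := Real.rpow_pos_of_pos hA0 _
  have hβ0 : 0 < β := Real.rpow_pos_of_pos hB0 _
  set s := p * α + q * β with hs
  have hs0 : 0 < s := by positivity
  have hαn : α ^ n = (volume A).toReal := by
    rw [hα, one_div, Real.rpow_inv_natCast_pow hA0.le hn]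
  have hβn : β ^ n = (volume B).toReal := by
    rw [hβ, one_div, Real.rpow_inv_natCast_pow hB0.le hn]
  have hvol : ∀ (r : ℝ) (S : Set (EuclideanSpace ℝ (Fin n))), 0 < r →
      volume (r⁻¹ • S) = ENNReal.ofReal ((r ^ n)⁻¹) * volume S := by
    intro r S hr
    rw [Measure.addHaar_smul, finrank_euclideanSpace_fin, abs_of_pos (by positivity), inv_pow]
  have hone : ∀ (r : ℝ) (S : Set (EuclideanSpace ℝ (Fin n))), 0 < r →
      0 < (volume S).toReal → r ^ n = (volume S).toReal → volume (r⁻¹ • S) = 1 := by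
    intro r S hr hS h
    rw [hvol r S hr, h, ← ENNReal.ofReal_toReal (ENNReal.toReal_pos_iff.1 hS).2.ne,
      ENNReal.toReal_ofReal hS.le, ← ENNReal.ofReal_mul (by positivity), inv_mul_cancel₀ hS.ne',
      ENNReal.ofReal_one]
  have key := bm_mul (n := n) (p := p * α / s) (q := q * β / s) (by positivity) (by positivity)
    (by rw [← add_div, ← hs, div_self hs0.ne']) (hA.const_smul₀ α⁻¹) (hB.const_smul₀ β⁻¹)
    (hC.const_smul₀ s⁻¹) (by
      rintro _ ⟨a, ha, rfl⟩ _ ⟨b, hb, rfl⟩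
      refine ⟨p • a + q • b, H a ha b hb, ?_⟩
      simp only [smul_add, smul_smul]
      congr 2 <;> field_simp)
  rw [hone α A hα0 hA0 hαn, hone β B hβ0 hB0 hβn, hvol s C hs0, ENNReal.one_rpow,
    ENNReal.one_rpow, one_mul, ← ENNReal.ofReal_toReal hCt, 
    ← ENNReal.ofReal_mul (by positivity), ENNReal.one_le_ofReal, inv_mul_eq_div,
    one_le_div (by positivity)] at key
  calc s = (s ^ n) ^ ((1:ℝ) / n) := by rw [one_div, Real.pow_rpow_inv_natCast hs0.le hn]
    _ ≤ _ := Real.rpow_le_rpow (by positivity) key (by positivity)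

/-- The covariogram of a convex body `K ⊆ ℝⁿ` is `1/n`-concave. -/
theorem statement13 {n : ℕ} (K : Set (EuclideanSpace ℝ (Fin n)))
    (hKcomp : IsCompact K) (hKconv : Convex ℝ K) (hKint : (interior K).Nonempty) :
    ∀ x y : EuclideanSpace ℝ (Fin n), 0 < covariogram K x → 0 < covariogram K y →
      ∀ lam : ℝ, lam ∈ Icc (0:ℝ) 1 →
        (1 - lam) * covariogram K x ^ ((1:ℝ) / n) + lam * covariogram K y ^ ((1:ℝ) / n) ≤
          covariogram K ((1 - lam) • x + lam • y) ^ ((1:ℝ) / n) := by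
  intro x y hx hy lam hlam
  rcases Nat.eq_zero_or_pos n with hn | hn
  · subst hn
    simp
  obtain ⟨h0, h1⟩ := hlam
  rcases h0.eq_or_lt with h0 | h0
  · simp [← h0]
  rcases h1.eq_or_lt with h1 | h1
  · simp [h1]
  have hc : ∀ z : EuclideanSpace ℝ (Fin n), IsCompact (K ∩ {y | y - z ∈ K}) := fun z =>
    hKcomp.inter_right (hKcomp.isClosed.preimage (continuous_id.sub continuous_const))
  refine bm_root hn.ne' (sub_pos.2 h1) h0 (hc x).measurableSet (hc y).measurableSet
    (hc _).measurableSet (hc _).measure_ne_top hx hy ?_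
  rintro a ⟨ha1, ha2⟩ b ⟨hb1, hb2⟩
  refine ⟨hKconv ha1 hb1 (sub_pos.2 h1).le h0.le (by ring), ?_⟩
  have := hKconv ha2 hb2 (sub_pos.2 h1).le h0.le (by ring)
  simp only [mem_setOf_eq]
  convert this using 1
  module
end
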